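/- arXiv:2003.01494 — 4 statements merged into one kernel-verified Lean document; each statement's English description precedes it below -/
import Mathlib

section
/- Let p be an odd prime, n ≥ 1, and k ≥ 1 an integer with 2k − 1 < p. If (2k+1)·p > 2n and (2k−1)·p < 2n (that is, p lies in the open interval (n/(k+1/2), n/(k−1/2))), then v_p((2n−1)!!) = k. -/
/-- Below `p ^ 2`, only the first term of Legendre's formula contributes. -/
theorem padicValNat_factorial_of_lt_sq {p m : ℕ} (hp : p.Prime) (hm : m < p ^ 2) :
    padicValNat p m.factorial = m / p := by
  have := Fact.mk hp
  have hlog : Nat.log p m < 2 := Nat.log_lt_of_lt_pow' two_ne_zero hm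
  simp [padicValNat_factorial hlog]

/-- The valuation of `(2n - 1)‼` at an odd prime, from `(2n)! = 2 ^ n * n ! * (2n - 1)‼`. -/
theorem padicValNat_factorial_two_mul {p n : ℕ} (hp : p.Prime) (hodd : Odd p) :
    padicValNat p (2 * n).factorial =
      padicValNat p n.factorial + padicValNat p (2 * n - 1).doubleFactorial := by
  have := Fact.mk hp
  have hfac : (2 * n).factorial =
      2 ^ n * n.factorial * (2 * n - 1).doubleFactorial := by
    rw [← Nat.doubleFactorial_two_mul]
    cases n with
    | zero => rfl
    | succ m => exact Nat.factorial_eq_mul_doubleFactorial (2 * m + 1)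
  have htwo : padicValNat p (2 ^ n) = 0 :=
    padicValNat.eq_zero_of_not_dvd fun h => by
      have := (Nat.prime_dvd_prime_iff_eq hp Nat.prime_two).1 (hp.dvd_of_dvd_pow h)
      subst this
      exact absurd hodd (by decide)
  rw [hfac, padicValNat.mul (mul_ne_zero (by positivity) n.factorial_ne_zero)
    (Nat.doubleFactorial_pos _).ne', padicValNat.mul (by positivity) n.factorial_ne_zero,
    htwo, zero_add]

open Nat in
/-- Proposition 2.1: if `p` is an odd prime, `1 ≤ k`, `2k − 1 < p`, and
`p ∈ (n/(k+1/2), n/(k−1/2))`, i.e. `(2k+1)p > 2n` and `(2k−1)p < 2n`,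
then `v_p((2n−1)!!) = k`. -/
theorem padicValNat_doubleFactorial_eq (p n k : ℕ) (hp : p.Prime) (hodd : Odd p)
    (hn : 1 ≤ n) (hk : 1 ≤ k) (hkp : 2 * k - 1 < p)
    (h1 : 2 * n < (2 * k + 1) * p) (h2 : (2 * k - 1) * p < 2 * n) :
    padicValNat p ((2 * n - 1)‼) = k := by
  have hle : 2 * k + 1 ≤ p := by
    obtain ⟨t, rfl⟩ := hodd
    omega
  have hlt : 2 * n < p ^ 2 := by nlinarith
  have hval := padicValNat_factorial_two_mul (n := n) hp hodd
  rw [padicValNat_factorial_of_lt_sq hp hlt,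
    padicValNat_factorial_of_lt_sq hp (by omega)] at hval
  suffices 2 * n / p = n / p + k by omega
  obtain ⟨j, rfl⟩ : ∃ j, k = j + 1 := ⟨k - 1, by omega⟩
  rw [show 2 * (j + 1) - 1 = 2 * j + 1 by omega] at h2
  rcases lt_or_ge n ((j + 1) * p) with h | h
  · rw [Nat.div_eq_of_lt_le (k := 2 * j + 1) (by linarith) (by linarith),
      Nat.div_eq_of_lt_le (k := j) (by linarith) h]
    ring
  · rw [Nat.div_eq_of_lt_le (k := 2 * j + 2) (by linarith) (by linarith),
      Nat.div_eq_of_lt_le (k := j + 1) h (by linarith)]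
    ring
end

section
/- Let p be an odd prime, n ≥ 1, and k ≥ 1 an integer with 2k − 1 < p. If k·p > n and (2k−1)·p < 2n (that is, p lies in the open interval S_k = (n/k, n/(k−1/2))), then v_p(C(2n, n)) = 1; that is, p is a non-repeated prime factor of the middle binomial coefficient B(n). -/
/-- Proposition 2.3 ('if' direction): if `p` is an odd prime, `1 ≤ k`,
`2k − 1 < p`, and `p` lies in the Chebyshev interval `S_k = (n/k, n/(k−1/2))`,
i.e. `kp > n` and `(2k−1)p < 2n`, then `v_p(C(2n, n)) = 1`. -/
theorem padicValNat_centralBinom_eq_one_of_mem_chebyshev (p n k : ℕ)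
    (hp : p.Prime) (hodd : Odd p) (hn : 1 ≤ n) (hk : 1 ≤ k)
    (hkp : 2 * k - 1 < p) (h1 : n < k * p) (h2 : (2 * k - 1) * p < 2 * n) :
    padicValNat p (Nat.centralBinom n) = 1 := by
  have : Fact p.Prime := ⟨hp⟩
  obtain ⟨m, rfl⟩ : ∃ m, k = m + 1 := ⟨k - 1, by omega⟩
  have hodd_coeff : 2 * (m + 1) - 1 = 2 * m + 1 := by omega
  rw [hodd_coeff] at hkp h2
  have hlog : Nat.log p (n + n) < 2 := by
    apply Nat.log_lt_of_lt_pow (by omega)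
    nlinarith
  obtain ⟨r, rfl⟩ : ∃ r, n = r + p * m := ⟨n - p * m, by
    have : p * m ≤ n := by nlinarith
    omega⟩
  have hr : r < p := by nlinarith
  have hr2 : p ≤ r + r := by nlinarith
  have hmod : (r + p * m) % p = r := by
    rw [Nat.add_mul_mod_self_left, Nat.mod_eq_of_lt hr]
  rw [Nat.centralBinom_eq_two_mul_choose, two_mul, padicValNat_choose' hlog]
  simp [Finset.filter_singleton, hmod, hr2]
end

section
/- Let p be a prime and let j ≥ 1, k ≥ 1 be integers. If n < k·p^j and (2k−1)·p^j < 2n (that is, p lies in the k-th Chebyshev interval ((n/k)^{1/j}, (n/(k−1/2))^{1/j}) of the j-th layer), then 2·(n mod p^j) ≥ p^j, so p is distributed in the j-th Legendre layer of B(n) and in particular p divides C(2n, n). -/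
/-- A prime `p` divides `C(2n, n)` as soon as adding `n` to itself in base `p` produces a carry
out of the `j` lowest digits. -/
theorem Nat.Prime.dvd_centralBinom_of_pow_le_two_mul_mod {p n j : ℕ} (hp : p.Prime) (hj : 1 ≤ j)
    (h : p ^ j ≤ 2 * (n % p ^ j)) : p ∣ Nat.centralBinom n := by
  refine Nat.dvd_of_factorization_pos (Nat.ne_of_gt ?_)
  rw [Nat.centralBinom_eq_two_mul_choose, two_mul,
    Nat.factorization_choose' hp (b := Nat.log p (n + n) + j + 1) (by lia)]
  exact Finset.card_pos.mpr ⟨j, by simp only [Finset.mem_filter, Finset.mem_Ico]; lia⟩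

/-- If `(k - 1/2) m < n < k m`, then the fractional part of `n / m` is at least `1/2`. -/
theorem Nat.le_two_mul_mod_of_lt_of_lt {n m k : ℕ} (h1 : n < k * m)
    (h2 : (2 * k - 1) * m < 2 * n) : m ≤ 2 * (n % m) := by
  have hq : n / m + 1 ≤ k := Nat.div_lt_of_lt_mul (by rwa [mul_comm] at h1)
  have hmul : (2 * (n / m) + 1) * m ≤ (2 * k - 1) * m := Nat.mul_le_mul_right m (by lia)
  linarith [Nat.div_add_mod n m]

/-- Formula (3.4): if a prime `p` lies in the `k`-th Chebyshev interval
`((n/k)^{1/j}, (n/(k−1/2))^{1/j})` of the `j`-th layer, i.e. `n < k·pʲ` and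
`(2k−1)·pʲ < 2n`, then `2·(n mod pʲ) ≥ pʲ`, so `p` is distributed in the
`j`-th Legendre layer of `B(n)`; in particular `p` divides `C(2n, n)`. -/
theorem mem_layer_of_mem_chebyshev_interval (p n j k : ℕ) (hp : p.Prime)
    (hj : 1 ≤ j) (hk : 1 ≤ k) (h1 : n < k * p ^ j) (h2 : (2 * k - 1) * p ^ j < 2 * n) :
    p ^ j ≤ 2 * (n % p ^ j) ∧ p ∣ Nat.centralBinom n := by
  have h := Nat.le_two_mul_mod_of_lt_of_lt h1 h2
  exact ⟨h, hp.dvd_centralBinom_of_pow_le_two_mul_mod hj h⟩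
end

section
/- Let p be an odd prime and k ≥ 1 an integer. If (2k−1)·p < 2n (that is, p < n/(k−1/2)), then v_p((2n−1)!!) ≥ k. -/
open Nat in
/-- Double factorials of odd numbers form a divisibility chain. -/
theorem doubleFactorial_odd_dvd_of_le {a b : ℕ} (hab : a ≤ b) :
    (2 * a + 1)‼ ∣ (2 * b + 1)‼ := by
  induction b, hab using Nat.le_induction with
  | base => exact dvd_rfl
  | succ b _ ih =>
    rw [show 2 * (b + 1) + 1 = 2 * b + 1 + 2 by ring, doubleFactorial_add_two]
    exact ih.mul_left _

open Nat in
/-- If the `k`-th odd multiple of an odd number `p` is at most `2 * m + 1`, then `p ^ k` divides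
`(2 * m + 1)‼`. -/
theorem Odd.pow_dvd_doubleFactorial {p : ℕ} (hp : Odd p) {k m : ℕ}
    (h : 2 * k * p ≤ 2 * m + 1 + p) : p ^ k ∣ (2 * m + 1)‼ := by
  induction k generalizing m with
  | zero => simp
  | succ k ih =>
    have hpos := hp.pos
    obtain ⟨j, hj⟩ : Odd ((2 * k + 1) * p) := (odd_two_mul_add_one k).mul hp
    refine dvd_trans ?_ (doubleFactorial_odd_dvd_of_le (a := j) (by lia))
    cases j with
    | zero =>
      have : p = 1 := Nat.eq_one_of_mul_eq_one_left hj
      simp [this]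
    | succ i =>
      rw [show 2 * (i + 1) + 1 = 2 * i + 1 + 2 by ring, doubleFactorial_add_two, pow_succ']
      exact mul_dvd_mul (Dvd.intro_left (2 * k + 1) (by lia)) (ih (by lia))

open Nat in
/-- Inequality (2.3): if `p` is an odd prime with `(2k−1)·p < 2n`
(that is, `p < n/(k−1/2)`), then `v_p((2n−1)!!) ≥ k`. -/
theorem le_padicValNat_doubleFactorial (p n k : ℕ) (hp : p.Prime)
    (hodd : Odd p) (hk : 1 ≤ k) (h : (2 * k - 1) * p < 2 * n) :
    k ≤ padicValNat p ((2 * n - 1)‼) := by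
  have : Fact p.Prime := ⟨hp⟩
  rw [← padicValNat_dvd_iff_le (doubleFactorial_pos _).ne']
  obtain ⟨m, rfl⟩ : ∃ m, n = m + 1 := ⟨n - 1, by lia⟩
  obtain ⟨l, rfl⟩ : ∃ l, k = l + 1 := ⟨k - 1, by lia⟩
  rw [show 2 * (l + 1) - 1 = 2 * l + 1 by lia] at h
  rw [show 2 * (m + 1) - 1 = 2 * m + 1 by lia]
  exact hodd.pow_dvd_doubleFactorial (by lia)
end
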